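/- Let F be a field, q ∈ F and f, g ∈ F[h]. Then the quantum generalized Heisenberg algebra H_q(f,g) is right Noetherian if and only if it is left Noetherian, if and only if deg f = 1 and q ≠ 0. -/

import Mathlib

open Polynomial

/-- The three generators `x`, `y`, `h` of a quantum generalized Heisenberg algebra. -/
inductive QGHAGen : Type
  | x : QGHAGen
  | y : QGHAGen
  | h : QGHAGen

/-- The defining relations of the quantum generalized Heisenberg algebra `H_q(f,g)`:
`h*x = x*f(h)`, `y*h = f(h)*y`, and `y*x - q*(x*y) = g(h)`. -/
inductive QGHARel (F : Type*) [Field F] (q : F) (f g : F[X]) :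
    FreeAlgebra F QGHAGen → FreeAlgebra F QGHAGen → Prop
  | hx : QGHARel F q f g
      (FreeAlgebra.ι F QGHAGen.h * FreeAlgebra.ι F QGHAGen.x)
      (FreeAlgebra.ι F QGHAGen.x * aeval (FreeAlgebra.ι F QGHAGen.h) f)
  | yh : QGHARel F q f g
      (FreeAlgebra.ι F QGHAGen.y * FreeAlgebra.ι F QGHAGen.h)
      (aeval (FreeAlgebra.ι F QGHAGen.h) f * FreeAlgebra.ι F QGHAGen.y)
  | yx : QGHARel F q f g
      (FreeAlgebra.ι F QGHAGen.y * FreeAlgebra.ι F QGHAGen.x)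
      (q • (FreeAlgebra.ι F QGHAGen.x * FreeAlgebra.ι F QGHAGen.y)
        + aeval (FreeAlgebra.ι F QGHAGen.h) g)

/-- The quantum generalized Heisenberg algebra `H_q(f,g)`. -/
def QGHA (F : Type*) [Field F] (q : F) (f g : F[X]) : Type _ :=
  RingQuot (QGHARel F q f g)

namespace QGHA

variable {F : Type*} [Field F] (q : F) (f g : F[X])

instance : Ring (QGHA F q f g) :=
  inferInstanceAs (Ring (RingQuot (QGHARel F q f g)))

instance : Algebra F (QGHA F q f g) :=
  inferInstanceAs (Algebra F (RingQuot (QGHARel F q f g)))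

/-- The generator `x` of `H_q(f,g)`. -/
def x : QGHA F q f g :=
  RingQuot.mkAlgHom F (QGHARel F q f g) (FreeAlgebra.ι F QGHAGen.x)

/-- The generator `y` of `H_q(f,g)`. -/
def y : QGHA F q f g :=
  RingQuot.mkAlgHom F (QGHARel F q f g) (FreeAlgebra.ι F QGHAGen.y)

/-- The generator `h` of `H_q(f,g)`. -/
def h : QGHA F q f g :=
  RingQuot.mkAlgHom F (QGHARel F q f g) (FreeAlgebra.ι F QGHAGen.h)

end QGHA

section HilbertBasis

variable {R S : Type*} [Ring R] [Ring S] (φ : R →+* S) (y : S)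

/-- The additive subgroup `∑_{i < n} yⁱ R` of `S`. -/
def rightSpanPowers (n : ℕ) : AddSubgroup S :=
  AddSubgroup.closure {z | ∃ i < n, ∃ r, z = y ^ i * φ r}

variable {φ y}

theorem rightSpanPowers_mono : Monotone (rightSpanPowers φ y) := by
  intro m n hmn
  refine AddSubgroup.closure_mono ?_
  rintro _ ⟨i, hi, r, rfl⟩
  exact ⟨i, hi.trans_le hmn, r, rfl⟩

theorem pow_mul_mem_rightSpanPowers {i n : ℕ} (hi : i < n) (r : R) :
    y ^ i * φ r ∈ rightSpanPowers φ y n :=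
  AddSubgroup.subset_closure ⟨i, hi, r, rfl⟩

theorem mem_rightSpanPowers_succ {n : ℕ} {z : S} (hz : z ∈ rightSpanPowers φ y (n + 1)) :
    ∃ r, ∃ s ∈ rightSpanPowers φ y n, z = y ^ n * φ r + s := by
  induction hz using AddSubgroup.closure_induction with
  | mem z hz =>
    obtain ⟨i, hi, r, rfl⟩ := hz
    rcases (Nat.lt_succ_iff_lt_or_eq.mp hi) with hi | rfl
    · exact ⟨0, _, pow_mul_mem_rightSpanPowers hi r, by simp⟩
    · exact ⟨r, 0, zero_mem _, by simp⟩
  | zero => exact ⟨0, 0, zero_mem _, by simp⟩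
  | add a b _ _ ha hb =>
    obtain ⟨r, s, hs, rfl⟩ := ha
    obtain ⟨r', s', hs', rfl⟩ := hb
    exact ⟨r + r', s + s', add_mem hs hs', by rw [map_add, mul_add]; abel⟩
  | neg a _ ha =>
    obtain ⟨r, s, hs, rfl⟩ := ha
    exact ⟨-r, -s, neg_mem hs, by rw [map_neg, mul_neg]; abel⟩

theorem mul_mem_rightSpanPowers_succ {n : ℕ} {z : S} (hz : z ∈ rightSpanPowers φ y n) :
    y * z ∈ rightSpanPowers φ y (n + 1) := by
  induction hz using AddSubgroup.closure_induction with
  | mem z hz =>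
    obtain ⟨i, hi, r, rfl⟩ := hz
    rw [← mul_assoc, ← pow_succ']
    exact pow_mul_mem_rightSpanPowers (by omega) r
  | zero => simp
  | add a b _ _ ha hb => rw [mul_add]; exact add_mem ha hb
  | neg a _ ha => rw [mul_neg]; exact neg_mem ha

theorem mul_map_mem_rightSpanPowers {n : ℕ} {z : S} (hz : z ∈ rightSpanPowers φ y n) (r : R) :
    z * φ r ∈ rightSpanPowers φ y n := by
  induction hz using AddSubgroup.closure_induction with
  | mem z hz =>
    obtain ⟨i, hi, r', rfl⟩ := hz
    rw [mul_assoc, ← map_mul]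
    exact pow_mul_mem_rightSpanPowers hi _
  | zero => simp
  | add a b _ _ ha hb => rw [add_mul]; exact add_mem ha hb
  | neg a _ ha => rw [neg_mul]; exact neg_mem ha

theorem map_mul_pow_mem_rightSpanPowers
    (hl : ∀ r, ∃ r₁ r₂, φ r * y = y * φ r₁ + φ r₂) (n : ℕ) (r : R) :
    φ r * y ^ n ∈ rightSpanPowers φ y (n + 1) := by
  induction n generalizing r with
  | zero => simpa using pow_mul_mem_rightSpanPowers (φ := φ) (y := y) zero_lt_one r
  | succ n ih =>
    obtain ⟨r₁, r₂, h⟩ := hl r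
    rw [pow_succ', ← mul_assoc, h, add_mul, mul_assoc]
    exact add_mem (mul_mem_rightSpanPowers_succ (ih r₁))
      (rightSpanPowers_mono (Nat.le_succ _) (ih r₂))

theorem map_mul_mem_rightSpanPowers
    (hl : ∀ r, ∃ r₁ r₂, φ r * y = y * φ r₁ + φ r₂) {n : ℕ} {z : S}
    (hz : z ∈ rightSpanPowers φ y n) (r : R) : φ r * z ∈ rightSpanPowers φ y n := by
  induction hz using AddSubgroup.closure_induction with
  | mem z hz =>
    obtain ⟨i, hi, r', rfl⟩ := hz
    rw [← mul_assoc]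
    exact mul_map_mem_rightSpanPowers
      (rightSpanPowers_mono hi (map_mul_pow_mem_rightSpanPowers hl i r)) r'
  | zero => simp
  | add a b _ _ ha hb => rw [mul_add]; exact add_mem ha hb
  | neg a _ ha => rw [mul_neg]; exact neg_mem ha

theorem exists_pow_mul_map_eq
    (hl : ∀ r, ∃ r₁ r₂, φ r * y = y * φ r₁ + φ r₂)
    (hr : ∀ r, ∃ r₁ r₂, y * φ r = φ r₁ * y + φ r₂) (n : ℕ) (r : R) :
    ∃ r', ∃ s ∈ rightSpanPowers φ y n, y ^ n * φ r = φ r' * y ^ n + s := by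
  induction n with
  | zero => exact ⟨r, 0, zero_mem _, by simp⟩
  | succ n ih =>
    obtain ⟨r', s, hs, h⟩ := ih
    obtain ⟨r₁, r₂, h'⟩ := hr r'
    refine ⟨r₁, φ r₂ * y ^ n + y * s, add_mem (map_mul_pow_mem_rightSpanPowers hl n r₂)
      (mul_mem_rightSpanPowers_succ hs), ?_⟩
    rw [pow_succ', mul_assoc, h, mul_add, ← mul_assoc, h', add_mul, mul_assoc, add_assoc]

theorem exists_mem_rightSpanPowers
    (hl : ∀ r, ∃ r₁ r₂, φ r * y = y * φ r₁ + φ r₂)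
    (hgen : ∀ T : Subring S, (∀ r, φ r ∈ T) → y ∈ T → T = ⊤) (z : S) :
    ∃ n, z ∈ rightSpanPowers φ y n := by
  let T : Subring S :=
    { carrier := {s | ∀ n, ∀ w ∈ rightSpanPowers φ y n, ∃ m, s * w ∈ rightSpanPowers φ y m}
      mul_mem' := by
        intro a b ha hb n w hw
        obtain ⟨m, hm⟩ := hb n w hw
        obtain ⟨k, hk⟩ := ha m _ hm
        exact ⟨k, by rwa [mul_assoc]⟩
      one_mem' := fun n w hw => ⟨n, by rwa [one_mul]⟩
      add_mem' := by
        intro a b ha hb n w hw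
        obtain ⟨m, hm⟩ := ha n w hw
        obtain ⟨k, hk⟩ := hb n w hw
        refine ⟨max m k, ?_⟩
        rw [add_mul]
        exact add_mem (rightSpanPowers_mono (le_max_left _ _) hm)
          (rightSpanPowers_mono (le_max_right _ _) hk)
      zero_mem' := fun n w _ => ⟨n, by rw [zero_mul]; exact zero_mem _⟩
      neg_mem' := by
        intro a ha n w hw
        obtain ⟨m, hm⟩ := ha n w hw
        exact ⟨m, by rw [neg_mul]; exact neg_mem hm⟩ }
  have hT : T = ⊤ := hgen T (fun r n w hw => ⟨n, map_mul_mem_rightSpanPowers hl hw r⟩)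
    (fun n w hw => ⟨n + 1, mul_mem_rightSpanPowers_succ hw⟩)
  have hz : z ∈ T := hT ▸ Subring.mem_top z
  obtain ⟨n, hn⟩ := hz 1 1
    (by simpa using pow_mul_mem_rightSpanPowers (φ := φ) (y := y) zero_lt_one 1)
  exact ⟨n, by rwa [mul_one] at hn⟩

/-- The left ideal of `R` of leading coefficients (written on the right of `yⁿ`) of the elements
of `I` having degree at most `n` in `y`. -/
def leadingIdeal
    (hl : ∀ r, ∃ r₁ r₂, φ r * y = y * φ r₁ + φ r₂)
    (hr : ∀ r, ∃ r₁ r₂, y * φ r = φ r₁ * y + φ r₂) (I : Ideal S) (n : ℕ) : Ideal R where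
  carrier := {r | ∃ s ∈ rightSpanPowers φ y n, y ^ n * φ r + s ∈ I}
  add_mem' := by
    rintro a b ⟨s, hs, h⟩ ⟨s', hs', h'⟩
    refine ⟨s + s', add_mem hs hs', ?_⟩
    have : y ^ n * φ (a + b) + (s + s') = (y ^ n * φ a + s) + (y ^ n * φ b + s') := by
      rw [map_add, mul_add]; abel
    rw [this]
    exact add_mem h h'
  zero_mem' := ⟨0, zero_mem _, by simp⟩
  smul_mem' := by
    rintro c r ⟨s, hs, h⟩
    obtain ⟨c', t, ht, hc⟩ := exists_pow_mul_map_eq hl hr n c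
    refine ⟨φ c' * s - t * φ r, sub_mem (map_mul_mem_rightSpanPowers hl hs c')
      (mul_map_mem_rightSpanPowers ht r), ?_⟩
    have : y ^ n * φ (c • r) + (φ c' * s - t * φ r) = φ c' * (y ^ n * φ r + s) := by
      rw [smul_eq_mul, map_mul, ← mul_assoc, hc, mul_add, add_mul, mul_assoc]; abel
    rw [this]
    exact I.mul_mem_left _ h

theorem leadingIdeal_mono
    (hl : ∀ r, ∃ r₁ r₂, φ r * y = y * φ r₁ + φ r₂)
    (hr : ∀ r, ∃ r₁ r₂, y * φ r = φ r₁ * y + φ r₂) {I J : Ideal S} (hIJ : I ≤ J)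
    {m n : ℕ} (hmn : m ≤ n) : leadingIdeal hl hr I m ≤ leadingIdeal hl hr J n := by
  have hstep : Monotone (leadingIdeal hl hr I) := by
    refine monotone_nat_of_le_succ fun k => ?_
    rintro r ⟨s, hs, h⟩
    refine ⟨y * s, mul_mem_rightSpanPowers_succ hs, ?_⟩
    rw [pow_succ', mul_assoc, ← mul_add]
    exact I.mul_mem_left _ h
  refine (hstep hmn).trans ?_
  rintro r ⟨s, hs, h⟩
  exact ⟨s, hs, hIJ h⟩

theorem le_of_leadingIdeal_le
    (hl : ∀ r, ∃ r₁ r₂, φ r * y = y * φ r₁ + φ r₂)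
    (hr : ∀ r, ∃ r₁ r₂, y * φ r = φ r₁ * y + φ r₂)
    (hgen : ∀ T : Subring S, (∀ r, φ r ∈ T) → y ∈ T → T = ⊤) {I J : Ideal S} (hIJ : I ≤ J)
    (h : ∀ n, leadingIdeal hl hr J n ≤ leadingIdeal hl hr I n) : J ≤ I := by
  have key : ∀ n, ∀ z ∈ rightSpanPowers φ y n, z ∈ J → z ∈ I := by
    intro n
    induction n with
    | zero =>
      intro z hz _
      have : z = 0 := by simpa [rightSpanPowers] using hz
      simp [this]
    | succ n ih =>
      intro z hz hzJ
      obtain ⟨r, s, hs, rfl⟩ := mem_rightSpanPowers_succ hz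
      obtain ⟨s', hs', hI⟩ := h n ⟨s, hs, hzJ⟩
      have hdiff : s - s' ∈ I := by
        refine ih _ (sub_mem hs hs') ?_
        simpa using sub_mem hzJ (hIJ hI)
      simpa using add_mem hI hdiff
  intro z hz
  obtain ⟨n, hn⟩ := exists_mem_rightSpanPowers hl hgen z
  exact key n z hn hz

/-- **Hilbert's basis theorem** for an overring of a left Noetherian ring `R` generated by `R` and
an element `y` such that `R y + R = y R + R`. -/
theorem isNoetherianRing_of_almost_normalizing [IsNoetherianRing R]
    (hl : ∀ r, ∃ r₁ r₂, φ r * y = y * φ r₁ + φ r₂)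
    (hr : ∀ r, ∃ r₁ r₂, y * φ r = φ r₁ * y + φ r₂)
    (hgen : ∀ T : Subring S, (∀ r, φ r ∈ T) → y ∈ T → T = ⊤) : IsNoetherianRing S := by
  refine monotone_stabilizes_iff_noetherian.mp fun I => ?_
  let L : ℕ → ℕ → Ideal R := fun k n => leadingIdeal hl hr (I k) n
  have hL : ∀ {k k' n n'}, k ≤ k' → n ≤ n' → L k n ≤ L k' n' := fun hk hn =>
    leadingIdeal_mono hl hr (I.monotone hk) hn
  obtain ⟨N, hN⟩ := monotone_stabilizes_iff_noetherian.mpr ‹IsNoetherianRing R›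
    ⟨fun k => L k k, fun _ _ h => hL h h⟩
  have hcol : ∀ n, ∃ K, ∀ k, K ≤ k → L K n = L k n := fun n =>
    monotone_stabilizes_iff_noetherian.mpr ‹IsNoetherianRing R›
      ⟨fun k => L k n, fun _ _ h => hL h le_rfl⟩
  choose K hK using hcol
  let B := max N ((Finset.range N).sup K)
  refine ⟨B, fun k hk => le_antisymm (I.monotone hk)
    (le_of_leadingIdeal_le hl hr hgen (I.monotone hk) fun n => ?_)⟩
  change L k n ≤ L B n
  rcases lt_or_ge n N with hn | hn
  · have hKB : K n ≤ B := (Finset.le_sup (Finset.mem_range.mpr hn)).trans (le_max_right _ _)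
    rw [← hK n k (hKB.trans hk), ← hK n B hKB]
  · have hNB : N ≤ B := le_max_left _ _
    calc L k n ≤ L (max k n) (max k n) := hL (le_max_left _ _) (le_max_right _ _)
      _ = L N N := (hN (max k n) (hn.trans (le_max_right _ _))).symm
      _ ≤ L B n := hL hNB hn

end HilbertBasis

namespace QGHA

section Presentation

variable {F : Type*} [Field F] {q : F} {f g : F[X]}

theorem aeval_h_eq (p : F[X]) : aeval (h q f g) p =
    RingQuot.mkAlgHom F (QGHARel F q f g) (aeval (FreeAlgebra.ι F QGHAGen.h) p) :=
  aeval_algHom_apply (RingQuot.mkAlgHom F (QGHARel F q f g)) _ p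

theorem h_mul_x : h q f g * x q f g = x q f g * aeval (h q f g) f := by
  rw [aeval_h_eq]
  exact ((map_mul _ _ _).symm.trans
    (RingQuot.mkAlgHom_rel F (QGHARel.hx (q := q) (f := f) (g := g)))).trans (map_mul _ _ _)

theorem y_mul_h : y q f g * h q f g = aeval (h q f g) f * y q f g := by
  rw [aeval_h_eq]
  exact ((map_mul _ _ _).symm.trans
    (RingQuot.mkAlgHom_rel F (QGHARel.yh (q := q) (f := f) (g := g)))).trans (map_mul _ _ _)

theorem y_mul_x : y q f g * x q f g = q • (x q f g * y q f g) + aeval (h q f g) g := by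
  rw [aeval_h_eq]
  refine ((map_mul _ _ _).symm.trans
    (RingQuot.mkAlgHom_rel F (QGHARel.yx (q := q) (f := f) (g := g)))).trans ?_
  rw [map_add, map_smul, map_mul]
  rfl

/-- The algebra homomorphism out of `H_q(f,g)` determined by images of the generators. -/
noncomputable def lift {A : Type*} [Ring A] [Algebra F A] (a b c : A)
    (hx : c * a = a * aeval c f) (yh : b * c = aeval c f * b)
    (yx : b * a = q • (a * b) + aeval c g) : QGHA F q f g →ₐ[F] A :=
  RingQuot.liftAlgHom F ⟨FreeAlgebra.lift F (fun t => QGHAGen.casesOn t a b c), by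
    intro u v huv
    cases huv <;> simp [← aeval_algHom_apply, hx, yh, yx]⟩

section lift

variable {A : Type*} [Ring A] [Algebra F A] {a b c : A}
    (hx : c * a = a * aeval c f) (yh : b * c = aeval c f * b)
    (yx : b * a = q • (a * b) + aeval c g)

theorem lift_x : lift a b c hx yh yx (x q f g) = a :=
  (RingQuot.liftAlgHom_mkAlgHom_apply F _ _ _).trans (FreeAlgebra.lift_ι_apply _ _)

theorem lift_y : lift a b c hx yh yx (y q f g) = b :=
  (RingQuot.liftAlgHom_mkAlgHom_apply F _ _ _).trans (FreeAlgebra.lift_ι_apply _ _)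

theorem lift_h : lift a b c hx yh yx (h q f g) = c :=
  (RingQuot.liftAlgHom_mkAlgHom_apply F _ _ _).trans (FreeAlgebra.lift_ι_apply _ _)

end lift

theorem subalgebra_eq_top {T : Subalgebra F (QGHA F q f g)} (hx : x q f g ∈ T)
    (hy : y q f g ∈ T) (hh : h q f g ∈ T) : T = ⊤ := by
  refine eq_top_iff.mpr fun z _ => ?_
  obtain ⟨w, rfl⟩ := RingQuot.mkAlgHom_surjective F (QGHARel F q f g) z
  induction w using FreeAlgebra.induction with
  | grade0 r => rw [AlgHom.commutes]; exact T.algebraMap_mem r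
  | grade1 t => cases t <;> assumption
  | mul a b ha hb => rw [map_mul]; exact T.mul_mem (ha trivial) (hb trivial)
  | add a b ha hb => rw [map_add]; exact T.add_mem (ha trivial) (hb trivial)

open MulOpposite in
/-- The anti-automorphism of `H_q(f,g)` exchanging `x` and `y` and fixing `h`. -/
noncomputable def toOp : QGHA F q f g →ₐ[F] (QGHA F q f g)ᵐᵒᵖ :=
  lift (op (y q f g)) (op (x q f g)) (op (h q f g))
    (by rw [aeval_op_apply, ← op_mul, ← op_mul, y_mul_h])
    (by rw [aeval_op_apply, ← op_mul, ← op_mul, h_mul_x])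
    (by rw [aeval_op_apply, ← op_mul, ← op_mul, y_mul_x, op_add, op_smul])

open MulOpposite in
theorem toOp_surjective : Function.Surjective (toOp (q := q) (f := f) (g := g)) := by
  let T : Subalgebra F (QGHA F q f g) :=
    { carrier := {z | ∃ w, toOp w = op z}
      mul_mem' := by
        rintro a b ⟨u, hu⟩ ⟨w, hw⟩
        exact ⟨w * u, by rw [map_mul, hu, hw, op_mul]⟩
      add_mem' := by
        rintro a b ⟨u, hu⟩ ⟨w, hw⟩
        exact ⟨u + w, by rw [map_add, hu, hw, op_add]⟩
      algebraMap_mem' := fun r => ⟨algebraMap F _ r, AlgHom.commutes _ r⟩ }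
  have hT : T = ⊤ := subalgebra_eq_top ⟨y q f g, lift_y _ _ _⟩ ⟨x q f g, lift_x _ _ _⟩
    ⟨h q f g, lift_h _ _ _⟩
  intro z
  have hz : unop z ∈ T := hT ▸ Algebra.mem_top
  exact hz

theorem isNoetherianRing_op_iff :
    IsNoetherianRing (QGHA F q f g)ᵐᵒᵖ ↔ IsNoetherianRing (QGHA F q f g) := by
  constructor
  · intro _
    refine isNoetherianRing_of_surjective (QGHA F q f g)ᵐᵒᵖ (QGHA F q f g)
      (AlgHom.opComm toOp).toRingHom fun z => ?_
    obtain ⟨w, hw⟩ := toOp_surjective (MulOpposite.op z)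
    exact ⟨MulOpposite.op w, congrArg MulOpposite.unop hw⟩
  · intro _
    exact isNoetherianRing_of_surjective (QGHA F q f g) (QGHA F q f g)ᵐᵒᵖ
      toOp.toRingHom toOp_surjective

end Presentation

section Noetherian

variable {F : Type*} [Field F] {q : F} {f g : F[X]}

theorem aeval_h_mul_x (p : F[X]) :
    aeval (h q f g) p * x q f g = x q f g * aeval (h q f g) (p.comp f) := by
  induction p using Polynomial.induction_on' with
  | add a b ha hb => simp only [map_add, add_mul, mul_add, add_comp, ha, hb]
  | monomial n r =>
    have hpow : h q f g ^ n * x q f g = x q f g * aeval (h q f g) f ^ n := by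
      induction n with
      | zero => simp
      | succ n ih => rw [pow_succ, mul_assoc, h_mul_x, ← mul_assoc, ih, mul_assoc, ← pow_succ]
    rw [aeval_monomial, monomial_comp, map_mul, map_pow, aeval_C, mul_assoc, hpow,
      Algebra.left_comm]

theorem y_mul_aeval_h (p : F[X]) :
    y q f g * aeval (h q f g) p = aeval (h q f g) (p.comp f) * y q f g := by
  induction p using Polynomial.induction_on' with
  | add a b ha hb => simp only [map_add, add_mul, mul_add, add_comp, ha, hb]
  | monomial n r =>
    have hpow : y q f g * h q f g ^ n = aeval (h q f g) f ^ n * y q f g := by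
      induction n with
      | zero => simp
      | succ n ih => rw [pow_succ', ← mul_assoc, y_mul_h, mul_assoc, ih, ← mul_assoc, ← pow_succ']
    rw [aeval_monomial, monomial_comp, map_mul, map_pow, aeval_C, Algebra.left_comm, hpow,
      mul_assoc]

/-- A polynomial of degree one has a left inverse under composition. -/
theorem exists_comp_eq_X (hf : f.degree = 1) : ∃ k : F[X], k.comp f = X := by
  have ha : f.coeff 1 ≠ 0 := coeff_ne_zero_of_eq_degree hf
  have hfe := eq_X_add_C_of_degree_le_one hf.le
  generalize f.coeff 1 = a at *
  generalize f.coeff 0 = b at *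
  subst hfe
  have hc : (C a * C a⁻¹ : F[X]) = 1 := by rw [← C_mul, mul_inv_cancel₀ ha, C_1]
  refine ⟨C a⁻¹ * (X - C b), ?_⟩
  simp only [sub_comp, mul_comp, C_comp, X_comp]
  linear_combination X * hc

variable (q f g) in
/-- The subalgebra of `H_q(f,g)` generated by `h` and `x`. -/
def borel : Subalgebra F (QGHA F q f g) := Algebra.adjoin F {h q f g, x q f g}

theorem h_mem_borel : h q f g ∈ borel q f g := Algebra.subset_adjoin (by simp)

theorem x_mem_borel : x q f g ∈ borel q f g := Algebra.subset_adjoin (by simp)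

theorem aeval_h_mem_borel (p : F[X]) : aeval (h q f g) p ∈ borel q f g :=
  Algebra.adjoin_mono (by simp) (aeval_mem_adjoin_singleton F (h q f g))

theorem isNoetherianRing_borel (hf : f.degree = 1) : IsNoetherianRing (borel q f g) := by
  obtain ⟨k, hk⟩ := exists_comp_eq_X hf
  let φ : F[X] →ₐ[F] borel q f g := (aeval (h q f g)).codRestrict _ aeval_h_mem_borel
  refine isNoetherianRing_of_almost_normalizing (φ := φ.toRingHom)
    (y := (⟨x q f g, x_mem_borel⟩ : borel q f g))
    (fun p => ⟨p.comp f, 0, ?_⟩) (fun p => ⟨p.comp k, 0, ?_⟩) fun T hφ hy => ?_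
  · rw [map_zero, add_zero]
    exact Subtype.ext (aeval_h_mul_x p)
  · rw [map_zero, add_zero]
    refine Subtype.ext ((aeval_h_mul_x (p.comp k)).trans ?_).symm
    rw [comp_assoc, hk, comp_X]
    rfl
  · refine eq_top_iff.mpr fun z _ => ?_
    obtain ⟨z, hz⟩ := z
    change z ∈ Algebra.adjoin F _ at hz
    induction hz using Algebra.adjoin_induction with
    | mem z hz =>
      rcases hz with rfl | rfl
      · convert hφ X
        exact Subtype.ext (aeval_X _).symm
      · exact hy
    | algebraMap r =>
      convert hφ (C r)
      exact Subtype.ext (aeval_C _ _).symm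
    | add a b ha hb iha ihb => exact T.add_mem (iha trivial) (ihb trivial)
    | mul a b ha hb iha ihb => exact T.mul_mem (iha trivial) (ihb trivial)

theorem isNoetherianRing_of_degree_eq_one (hf : f.degree = 1) (hq : q ≠ 0) :
    IsNoetherianRing (QGHA F q f g) := by
  obtain ⟨k, hk⟩ := exists_comp_eq_X hf
  have := isNoetherianRing_borel (q := q) (g := g) hf
  have hky : h q f g * y q f g = y q f g * aeval (h q f g) k := by
    rw [y_mul_aeval_h, hk, aeval_X]
  have hxy : x q f g * y q f g =
      y q f g * (q⁻¹ • x q f g) + -(q⁻¹ • aeval (h q f g) g) := by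
    rw [mul_smul_comm, y_mul_x, smul_add, inv_smul_smul₀ hq, add_neg_cancel_right]
  refine isNoetherianRing_of_almost_normalizing (φ := (borel q f g).val.toRingHom)
    (y := y q f g) (fun ⟨r, hr⟩ => ?_) (fun ⟨r, hr⟩ => ?_) fun T hφ hy => ?_
  · suffices ∃ r₁ ∈ borel q f g, ∃ r₂ ∈ borel q f g, r * y q f g = y q f g * r₁ + r₂ by
      obtain ⟨r₁, h₁, r₂, h₂, h⟩ := this
      exact ⟨⟨r₁, h₁⟩, ⟨r₂, h₂⟩, h⟩
    change r ∈ Algebra.adjoin F _ at hr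
    induction hr using Algebra.adjoin_induction with
    | mem z hz =>
      rcases hz with rfl | rfl
      · exact ⟨_, aeval_h_mem_borel k, 0, zero_mem _, by rw [hky, add_zero]⟩
      · exact ⟨_, Subalgebra.smul_mem _ x_mem_borel _, _,
          neg_mem (Subalgebra.smul_mem _ (aeval_h_mem_borel g) _), hxy⟩
    | algebraMap r =>
      exact ⟨_, Subalgebra.algebraMap_mem _ r, 0, zero_mem _, by
        rw [Algebra.commutes, add_zero]⟩
    | add a b _ _ ha hb =>
      obtain ⟨r₁, h₁, r₂, h₂, h⟩ := ha
      obtain ⟨s₁, k₁, s₂, k₂, k⟩ := hb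
      exact ⟨_, add_mem h₁ k₁, _, add_mem h₂ k₂, by rw [add_mul, h, k, mul_add]; abel⟩
    | mul a b ha' _ ha hb =>
      obtain ⟨r₁, h₁, r₂, h₂, h⟩ := ha
      obtain ⟨s₁, k₁, s₂, k₂, k⟩ := hb
      exact ⟨_, mul_mem h₁ k₁, _, add_mem (mul_mem h₂ k₁) (mul_mem ha' k₂), by
        rw [mul_assoc, k, mul_add, ← mul_assoc, h]; noncomm_ring⟩
  · suffices ∃ r₁ ∈ borel q f g, ∃ r₂ ∈ borel q f g, y q f g * r = r₁ * y q f g + r₂ by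
      obtain ⟨r₁, h₁, r₂, h₂, h⟩ := this
      exact ⟨⟨r₁, h₁⟩, ⟨r₂, h₂⟩, h⟩
    change r ∈ Algebra.adjoin F _ at hr
    induction hr using Algebra.adjoin_induction with
    | mem z hz =>
      rcases hz with rfl | rfl
      · exact ⟨_, aeval_h_mem_borel f, 0, zero_mem _, by rw [y_mul_h, add_zero]⟩
      · exact ⟨_, Subalgebra.smul_mem _ x_mem_borel q, _, aeval_h_mem_borel g, by
          rw [y_mul_x, smul_mul_assoc]⟩
    | algebraMap r =>
      exact ⟨_, Subalgebra.algebraMap_mem _ r, 0, zero_mem _, by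
        rw [Algebra.commutes, add_zero]⟩
    | add a b _ _ ha hb =>
      obtain ⟨r₁, h₁, r₂, h₂, h⟩ := ha
      obtain ⟨s₁, k₁, s₂, k₂, k⟩ := hb
      exact ⟨_, add_mem h₁ k₁, _, add_mem h₂ k₂, by rw [mul_add, h, k, add_mul]; abel⟩
    | mul a b _ hb' ha hb =>
      obtain ⟨r₁, h₁, r₂, h₂, h⟩ := ha
      obtain ⟨s₁, k₁, s₂, k₂, k⟩ := hb
      exact ⟨_, mul_mem h₁ k₁, _, add_mem (mul_mem h₁ k₂) (mul_mem h₂ hb'), by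
        rw [← mul_assoc, h, add_mul, mul_assoc, k]; noncomm_ring⟩
  · have hT : ({ T with
        algebraMap_mem' := fun r => hφ (algebraMap F (borel q f g) r) } :
        Subalgebra F (QGHA F q f g)) = ⊤ :=
      subalgebra_eq_top (hφ ⟨_, x_mem_borel⟩) hy (hφ ⟨_, h_mem_borel⟩)
    refine eq_top_iff.mpr fun z _ => ?_
    have hz : z ∈ (⊤ : Subalgebra F (QGHA F q f g)) := Algebra.mem_top
    rw [← hT] at hz
    exact hz

end Noetherian

end QGHA

namespace QGHA

section NotNoetherian

variable {F : Type*} [Field F] {q : F} {f g : F[X]}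

/-- A strictly increasing chain of subrepresentations, with the strictness witnessed inside a
cyclic subrepresentation, prevents `H_q(f,g)` from being left Noetherian. -/
theorem not_isNoetherianRing_of_chain {M : Type*} [AddCommGroup M] [Module F M]
    (ρ : QGHA F q f g →ₐ[F] Module.End F M) (v : M) (S : ℕ → Submodule F M) (hS : Monotone S)
    (hx : ∀ n, S n ≤ (S n).comap (ρ (x q f g))) (hy : ∀ n, S n ≤ (S n).comap (ρ (y q f g)))
    (hh : ∀ n, S n ≤ (S n).comap (ρ (h q f g))) (z : ℕ → QGHA F q f g)
    (hz : ∀ n, ρ (z n) v ∈ S (n + 1)) (hz' : ∀ n, ρ (z n) v ∉ S n) :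
    ¬ IsNoetherianRing (QGHA F q f g) := by
  intro hN
  have hstable : ∀ n w, ∀ m ∈ S n, ρ w m ∈ S n := by
    intro n w
    let T : Subalgebra F (QGHA F q f g) :=
      { carrier := {w | ∀ m ∈ S n, ρ w m ∈ S n}
        mul_mem' := by
          intro a b ha hb m hm
          rw [map_mul]
          exact ha _ (hb m hm)
        add_mem' := by
          intro a b ha hb m hm
          rw [map_add]
          exact add_mem (ha m hm) (hb m hm)
        algebraMap_mem' := by
          intro r m hm
          rw [AlgHom.commutes]
          exact (S n).smul_mem r hm }
    have hT : T = ⊤ := subalgebra_eq_top (fun m hm => hx n hm) (fun m hm => hy n hm)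
      (fun m hm => hh n hm)
    exact (hT ▸ Algebra.mem_top : w ∈ T)
  let J : ℕ →o Ideal (QGHA F q f g) :=
    { toFun := fun n =>
        { carrier := {w | ρ w v ∈ S n}
          add_mem' := by
            intro a b ha hb
            change ρ (a + b) v ∈ S n
            rw [map_add]
            exact add_mem ha hb
          zero_mem' := by
            change ρ 0 v ∈ S n
            rw [map_zero]
            exact zero_mem _
          smul_mem' := by
            intro c w hw
            change ρ (c * w) v ∈ S n
            rw [map_mul]
            exact hstable n c _ hw }
      monotone' := fun m n hmn w hw => hS hmn hw }
  obtain ⟨n, hn⟩ := monotone_stabilizes_iff_noetherian.mpr hN J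
  have hmem : z n ∈ J (n + 1) := hz n
  rw [← hn (n + 1) n.le_succ] at hmem
  exact hz' n hmem

section Representation

variable (q f g)

/-- The coefficients `cᵢ(h)` in `y xⁱ = qⁱ xⁱ y + xⁱ⁻¹ cᵢ(h)`. -/
noncomputable def lowerCoeff : ℕ → F[X]
  | 0 => 0
  | i + 1 => C q * lowerCoeff i + (aeval f ^ i : F[X] →ₐ[F] F[X]) g

/-- The action of `x` on `⨁ xⁱ F[h] yᵏ`. -/
noncomputable def opX : Module.End F (ℕ × ℕ →₀ F[X]) :=
  Finsupp.lsum F fun t => Finsupp.lsingle (t.1 + 1, t.2)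

/-- The action of `y` on `⨁ xⁱ F[h] yᵏ`. -/
noncomputable def opY : Module.End F (ℕ × ℕ →₀ F[X]) :=
  Finsupp.lsum F fun t =>
    q ^ t.1 • Finsupp.lsingle (t.1, t.2 + 1) ∘ₗ (aeval f : F[X] →ₐ[F] F[X]).toLinearMap +
      Finsupp.lsingle (t.1 - 1, t.2) ∘ₗ LinearMap.mulLeft F (lowerCoeff q f g t.1)

/-- The action of `p(h)` on `⨁ xⁱ F[h] yᵏ`. -/
noncomputable def opPoly (p : F[X]) : Module.End F (ℕ × ℕ →₀ F[X]) :=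
  Finsupp.lsum F fun t => Finsupp.lsingle t ∘ₗ
    LinearMap.mulLeft F ((aeval f ^ t.1 : F[X] →ₐ[F] F[X]) p)

variable {q f g}

@[simp]
theorem opX_single (i k : ℕ) (r : F[X]) :
    opX (Finsupp.single (i, k) r) = Finsupp.single (i + 1, k) r := by
  simp [opX]

@[simp]
theorem opY_single (i k : ℕ) (r : F[X]) :
    opY q f g (Finsupp.single (i, k) r) = q ^ i • Finsupp.single (i, k + 1) (aeval f r) +
      Finsupp.single (i - 1, k) (lowerCoeff q f g i * r) := by
  simp [opY, -Finsupp.single_mul]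

@[simp]
theorem opPoly_single (p : F[X]) (i k : ℕ) (r : F[X]) :
    opPoly f p (Finsupp.single (i, k) r) =
      Finsupp.single (i, k) ((aeval f ^ i : F[X] →ₐ[F] F[X]) p * r) := by
  simp [opPoly, -Finsupp.single_mul]

theorem aeval_pow_succ_apply (i : ℕ) (p : F[X]) :
    (aeval f ^ (i + 1) : F[X] →ₐ[F] F[X]) p =
      (aeval f ^ i : F[X] →ₐ[F] F[X]) (aeval f p) := by
  rw [pow_succ]; rfl

theorem aeval_pow_succ_apply' (i : ℕ) (p : F[X]) :
    (aeval f ^ (i + 1) : F[X] →ₐ[F] F[X]) p =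
      aeval f ((aeval f ^ i : F[X] →ₐ[F] F[X]) p) := by
  rw [pow_succ']; rfl

theorem end_ext {A B : Module.End F (ℕ × ℕ →₀ F[X])}
    (hAB : ∀ i k r, A (Finsupp.single (i, k) r) = B (Finsupp.single (i, k) r)) : A = B :=
  Finsupp.lhom_ext fun t r => hAB t.1 t.2 r

theorem aeval_opPoly (p : F[X]) : aeval (opPoly f X) p = opPoly f p := by
  let Ψ : F[X] →ₐ[F] Module.End F (ℕ × ℕ →₀ F[X]) :=
    AlgHom.ofLinearMap
      { toFun := opPoly f
        map_add' := fun a b => end_ext fun i k r => by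
          simp [-Finsupp.single_mul, -AlgHom.coe_pow, add_mul]
        map_smul' := fun c a => end_ext fun i k r => by
          simp [-Finsupp.single_mul, -AlgHom.coe_pow] }
      (end_ext fun i k r => by simp [-Finsupp.single_mul, -AlgHom.coe_pow])
      (fun a b => end_ext fun i k r => by
        simp [-Finsupp.single_mul, -AlgHom.coe_pow, mul_assoc])
  exact (aeval_algHom_apply Ψ X p).trans (congrArg Ψ (aeval_X_left_apply p))

variable (q f g) in
/-- The representation of `H_q(f,g)` on `⨁ xⁱ F[h] yᵏ`, which is the left regular representation
written in the basis `xⁱ hʲ yᵏ`. -/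
noncomputable def regularRep : QGHA F q f g →ₐ[F] Module.End F (ℕ × ℕ →₀ F[X]) :=
  lift opX (opY q f g) (opPoly f X)
    (by
      rw [aeval_opPoly]
      refine end_ext fun i k r => ?_
      simp only [Module.End.mul_apply, opX_single, opPoly_single, aeval_pow_succ_apply, aeval_X])
    (by
      rw [aeval_opPoly]
      refine end_ext fun i k r => ?_
      have hX : aeval f ((aeval f ^ i : F[X] →ₐ[F] F[X]) X) =
          (aeval f ^ i : F[X] →ₐ[F] F[X]) f := by
        rw [← aeval_pow_succ_apply', aeval_pow_succ_apply, aeval_X]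
      simp only [Module.End.mul_apply, opY_single, opPoly_single, map_add, map_smul, map_mul, hX]
      cases i with
      | zero => simp only [lowerCoeff, zero_mul, mul_zero]
      | succ i =>
        simp only [add_tsub_cancel_right, aeval_pow_succ_apply i X, aeval_X, mul_left_comm])
    (by
      rw [aeval_opPoly]
      refine end_ext fun i k r => ?_
      simp only [Module.End.mul_apply, LinearMap.add_apply, LinearMap.smul_apply, opX_single,
        opY_single, opPoly_single, map_add, map_smul, add_tsub_cancel_right, lowerCoeff, add_mul,
        Finsupp.single_add, smul_add, smul_smul, ← pow_succ', ← add_assoc]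
      cases i with
      | zero => simp only [lowerCoeff, zero_mul, mul_zero, Finsupp.single_zero, smul_zero]
      | succ i =>
        simp only [add_tsub_cancel_right, ← smul_eq_C_mul, Finsupp.smul_single, smul_mul_assoc])

@[simp]
theorem regularRep_x : regularRep q f g (x q f g) = opX := lift_x _ _ _

@[simp]
theorem regularRep_y : regularRep q f g (y q f g) = opY q f g := lift_y _ _ _

@[simp]
theorem regularRep_h : regularRep q f g (h q f g) = opPoly f X := lift_h _ _ _

theorem regularRep_aeval_h (p : F[X]) :
    regularRep q f g (aeval (h q f g) p) = opPoly f p := by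
  rw [← aeval_algHom_apply, regularRep_h, aeval_opPoly]

theorem regularRep_y_pow (n : ℕ) :
    regularRep q f g (y q f g ^ n) (Finsupp.single (0, 0) 1) = Finsupp.single (0, n) 1 := by
  induction n with
  | zero => simp
  | succ n ih =>
    rw [pow_succ', map_mul, Module.End.mul_apply, ih]
    simp [lowerCoeff]

/-- The subspace `⨁ xⁱ Iₖ yᵏ` determined by a sequence of ideals `Iₖ` of `F[h]`. -/
noncomputable def idealSum (I : ℕ → Ideal F[X]) : Submodule F (ℕ × ℕ →₀ F[X]) :=
  Finsupp.submodule fun t => (I t.2).restrictScalars F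

theorem single_mem_idealSum {I : ℕ → Ideal F[X]} {i k : ℕ} {r : F[X]} (hr : r ∈ I k) :
    Finsupp.single (i, k) r ∈ idealSum I := by
  classical
  intro t
  rw [Finsupp.single_apply]
  split_ifs with ht
  · exact ht ▸ hr
  · exact zero_mem _

theorem idealSum_le_comap {I : ℕ → Ideal F[X]} {A : Module.End F (ℕ × ℕ →₀ F[X])}
    {Q : Submodule F (ℕ × ℕ →₀ F[X])}
    (hA : ∀ i k, ∀ r ∈ I k, A (Finsupp.single (i, k) r) ∈ Q) : idealSum I ≤ Q.comap A := by
  rw [idealSum, Finsupp.submodule_eq_iSup]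
  refine iSup_le fun t => ?_
  rintro _ ⟨r, hr, rfl⟩
  exact hA t.1 t.2 r hr

theorem idealSum_mono {I J : ℕ → Ideal F[X]} (hIJ : ∀ k, I k ≤ J k) : idealSum I ≤ idealSum J :=
  fun _ hr t => hIJ t.2 (hr t)

end Representation

theorem not_isNoetherianRing_of_degree_ne_one (hf : f.degree ≠ 1) :
    ¬ IsNoetherianRing (QGHA F q f g) := by
  have hf' : f.natDegree ≠ 1 := fun h => hf ((degree_eq_iff_natDegree_eq_of_pos one_pos).mpr h)
  let a : F[X] := f - X
  have ha0 : a ≠ 0 := fun h => hf' (by rw [sub_eq_zero.mp h, natDegree_X])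
  have hdeg : 1 ≤ a.natDegree := by
    by_contra h
    have hC := eq_C_of_natDegree_eq_zero (by omega : a.natDegree = 0)
    apply hf'
    rw [show f = X + C (a.coeff 0) by rw [← hC]; simp [a], natDegree_X_add_C]
  have hdvd : a ∣ aeval f a := by
    have h := sub_dvd_eval_sub f X (f.map C)
    rw [eval_map, eval_map] at h
    simpa [a, aeval_def, algebraMap_eq] using h
  have hndvd : ¬ aeval f a ∣ a := by
    intro h
    have hle := natDegree_le_of_dvd h ha0
    have hcomp : (aeval f a).natDegree = a.natDegree * f.natDegree := natDegree_comp
    rw [hcomp] at hle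
    have h0 : f.natDegree = 0 := by
      by_contra h0
      have : a.natDegree * 2 ≤ a.natDegree * f.natDegree := Nat.mul_le_mul_left _ (by omega)
      omega
    obtain ⟨b, hb⟩ := natDegree_eq_zero.mp h0
    refine ha0 (zero_dvd_iff.mp ?_)
    rwa [show aeval f a = 0 by simp [a, ← hb]] at h
  have hmap : ∀ r ∈ Ideal.span {a}, aeval f r ∈ Ideal.span {aeval f a} := by
    intro r hr
    obtain ⟨c, rfl⟩ := Ideal.mem_span_singleton.mp hr
    rw [map_mul]
    exact Ideal.mem_span_singleton.mpr (dvd_mul_right _ _)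
  clear_value a
  let I : ℕ → ℕ → Ideal F[X] := fun n k => Ideal.span {if k < n then a else aeval f a}
  have hle : ∀ n k, Ideal.span {aeval f a} ≤ I n k := by
    intro n k
    refine Ideal.span_singleton_le_span_singleton.mpr ?_
    split_ifs
    · exact hdvd
    · exact dvd_rfl
  have hle' : ∀ n k, I n k ≤ Ideal.span {a} := by
    intro n k
    refine Ideal.span_singleton_le_span_singleton.mpr ?_
    split_ifs
    · exact dvd_rfl
    · exact hdvd
  have hI : ∀ {n k r}, k < n → r ∈ Ideal.span {a} → r ∈ I n k := by
    intro n k r hk hr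
    simpa only [I, if_pos hk] using hr
  refine not_isNoetherianRing_of_chain (regularRep q f g) (Finsupp.single (0, 0) 1)
    (fun n => idealSum (I n)) ?_
    (fun n => idealSum_le_comap fun i k r hr => ?_)
    (fun n => idealSum_le_comap fun i k r hr => ?_)
    (fun n => idealSum_le_comap fun i k r hr => ?_)
    (fun n => aeval (h q f g) a * y q f g ^ n) (fun n => ?_) (fun n hn => ?_)
  · refine fun m n hmn => idealSum_mono fun k => ?_
    by_cases hk : k < m
    · exact fun r hr => hI (hk.trans_le hmn) (hle' m k hr)
    · simpa only [I, if_neg hk] using hle n k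
  · rw [regularRep_x, opX_single]
    exact single_mem_idealSum hr
  · rw [regularRep_y, opY_single]
    refine add_mem (Submodule.smul_mem _ _ (single_mem_idealSum (hle _ _ ?_)))
      (single_mem_idealSum (Ideal.mul_mem_left _ _ hr))
    exact hmap r (hle' n k hr)
  · rw [regularRep_h, opPoly_single]
    exact single_mem_idealSum (Ideal.mul_mem_left _ _ hr)
  · rw [map_mul, Module.End.mul_apply, regularRep_y_pow, regularRep_aeval_h, opPoly_single]
    refine single_mem_idealSum (hI n.lt_succ_self ?_)
    rw [pow_zero, AlgHom.one_apply, mul_one]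
    exact Ideal.mem_span_singleton_self a
  · rw [map_mul, Module.End.mul_apply, regularRep_y_pow, regularRep_aeval_h, opPoly_single] at hn
    have h := hn (0, n)
    rw [Finsupp.single_eq_same, pow_zero, AlgHom.one_apply, mul_one] at h
    refine hndvd (Ideal.mem_span_singleton.mp ?_)
    simpa only [I, if_neg (lt_irrefl n), Submodule.restrictScalars_mem] using h

variable (f) in
/-- Right multiplication by `x y - p(h)`, sending `xⁱ r yᵏ` to `xⁱ r (x y - p(h)) yᵏ`. -/
noncomputable def mulKernel (p : F[X]) : Module.End F (ℕ × ℕ →₀ F[X]) :=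
  Finsupp.lsum F fun t =>
    Finsupp.lsingle (t.1 + 1, t.2 + 1) ∘ₗ (aeval f : F[X] →ₐ[F] F[X]).toLinearMap -
      Finsupp.lsingle t ∘ₗ LinearMap.mulLeft F p

theorem mulKernel_single (p : F[X]) (i k : ℕ) (r : F[X]) :
    mulKernel f p (Finsupp.single (i, k) r) =
      Finsupp.single (i + 1, k + 1) (aeval f r) - Finsupp.single (i, k) (p * r) := by
  simp [mulKernel, -Finsupp.single_mul]

theorem opPoly_mulKernel_single (p : F[X]) (i k : ℕ) (r : F[X]) :
    opPoly f X (mulKernel f p (Finsupp.single (i, k) r)) =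
      mulKernel f p (Finsupp.single (i, k) ((aeval f ^ i : F[X] →ₐ[F] F[X]) X * r)) := by
  simp only [mulKernel_single, map_sub, opPoly_single, map_mul, aeval_pow_succ_apply',
    mul_left_comm]

theorem opY_mulKernel_single {p : F[X]} (hp : aeval f p = g) (i k : ℕ) (r : F[X]) :
    opY 0 f g (mulKernel f p (Finsupp.single (i, k) r)) =
      mulKernel f p (Finsupp.single (i - 1, k) (lowerCoeff 0 f g i * r)) := by
  cases i with
  | zero => simp [-Finsupp.single_mul, mulKernel_single, lowerCoeff, hp]
  | succ i =>
    simp [-Finsupp.single_mul, -AlgHom.coe_pow, mulKernel_single, lowerCoeff,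
      ← aeval_pow_succ_apply', mul_left_comm]

theorem not_isNoetherianRing_zero (hf : f.degree = 1) :
    ¬ IsNoetherianRing (QGHA F 0 f g) := by
  obtain ⟨k, hk⟩ := exists_comp_eq_X hf
  let p := g.comp k
  have hp : aeval f p = g := by
    change (g.comp k).comp f = g
    rw [comp_assoc, hk, comp_X]
  have hsingle : ∀ n, regularRep 0 f g
      ((x 0 f g * y 0 f g - aeval (h 0 f g) p) * y 0 f g ^ n) (Finsupp.single (0, 0) 1) =
      mulKernel f p (Finsupp.single (0, n) 1) := by
    intro n
    rw [map_mul, Module.End.mul_apply, regularRep_y_pow, map_sub, regularRep_aeval_h]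
    simp [mulKernel_single, lowerCoeff]
  let I : ℕ → ℕ → Ideal F[X] := fun n k => if k < n then ⊤ else ⊥
  have hI : ∀ {n k}, k < n → I n k = ⊤ := fun hk => if_pos hk
  have hI' : ∀ {n k}, ¬ k < n → I n k = ⊥ := fun hk => if_neg hk
  have hmono : ∀ {m n k l}, (k < m → l < n) → I m k ≤ I n l := by
    intro m n k l hkl
    by_cases hk : k < m
    · rw [hI (hkl hk)]
      exact le_top
    · rw [hI' hk]
      exact bot_le
  refine not_isNoetherianRing_of_chain (regularRep 0 f g) (Finsupp.single (0, 0) 1)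
    (fun n => (idealSum (I n)).map (mulKernel f p)) ?_
    (fun n => ?_) (fun n => ?_) (fun n => ?_)
    (fun n => (x 0 f g * y 0 f g - aeval (h 0 f g) p) * y 0 f g ^ n) (fun n => ?_)
    (fun n hn => ?_)
  · exact fun m n hmn => Submodule.map_mono (idealSum_mono fun k => hmono fun hk => hk.trans_le hmn)
  · rw [Submodule.map_le_iff_le_comap]
    refine idealSum_le_comap (A := mulKernel f p) fun i k r hr => ?_
    refine ⟨Finsupp.single (i + 1, k) r, single_mem_idealSum hr, ?_⟩
    simp [-Finsupp.single_mul, mulKernel_single]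
  · rw [Submodule.map_le_iff_le_comap]
    refine idealSum_le_comap (A := mulKernel f p) fun i k r hr => ?_
    rw [Submodule.mem_comap, regularRep_y, opY_mulKernel_single hp]
    exact Submodule.mem_map_of_mem (single_mem_idealSum (Ideal.mul_mem_left _ _ hr))
  · rw [Submodule.map_le_iff_le_comap]
    refine idealSum_le_comap (A := mulKernel f p) fun i k r hr => ?_
    rw [Submodule.mem_comap, regularRep_h, opPoly_mulKernel_single]
    exact Submodule.mem_map_of_mem (single_mem_idealSum (Ideal.mul_mem_left _ _ hr))
  · rw [hsingle]
    refine Submodule.mem_map_of_mem (single_mem_idealSum ?_)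
    rw [hI n.lt_succ_self]
    exact Submodule.mem_top
  · have hle : (idealSum (I n)).map (mulKernel f p) ≤ idealSum (I (n + 1)) := by
      rw [Submodule.map_le_iff_le_comap]
      refine idealSum_le_comap fun i k r hr => ?_
      rw [mulKernel_single]
      refine sub_mem (single_mem_idealSum ?_)
        (single_mem_idealSum (Ideal.mul_mem_left _ _ (hmono (by omega) hr)))
      by_cases hkn : k < n
      · rw [hI (Nat.succ_lt_succ hkn)]
        exact Submodule.mem_top
      · rw [hI' hkn] at hr
        rw [(Submodule.mem_bot _).mp hr, map_zero]
        exact zero_mem _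
    rw [hsingle] at hn
    have h := hle hn (1, n + 1)
    simp [mulKernel_single, hI'] at h

end NotNoetherian

end QGHA

/-- `H_q(f,g)` is right Noetherian iff it is left Noetherian, iff
`deg f = 1` and `q ≠ 0`.  (Right Noetherian is expressed as left Noetherian of the
opposite ring.) -/
theorem qgha_noetherian_iff {F : Type*} [Field F] (q : F) (f g : F[X]) :
    (IsNoetherianRing (QGHA F q f g)ᵐᵒᵖ ↔ IsNoetherianRing (QGHA F q f g)) ∧
    (IsNoetherianRing (QGHA F q f g) ↔ (f.degree = 1 ∧ q ≠ 0)) := by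
  refine ⟨QGHA.isNoetherianRing_op_iff, fun hN => ?_, fun h =>
    QGHA.isNoetherianRing_of_degree_eq_one h.1 h.2⟩
  have hf : f.degree = 1 := by
    by_contra hf
    exact QGHA.not_isNoetherianRing_of_degree_ne_one hf hN
  refine ⟨hf, ?_⟩
  rintro rfl
  exact QGHA.not_isNoetherianRing_zero hf hN
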